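/- Every y^β-admissible directed path in the quantum Bruhat graph Γ_n whose terminal vertex is the longest permutation w_o has weight 0 in ℤ^{n−1}; equivalently, every edge of such a path satisfies the length-increasing condition ℓ(u s_{ij}) = ℓ(u) + 1, so the path is a saturated chain in the Bruhat order. -/

import Mathlib

open Equiv

/-- Number of inversions of a permutation of `Fin n` (its Coxeter length). -/
def len (n : ℕ) (w : Equiv.Perm (Fin n)) : ℕ :=
  (Finset.univ.filter (fun p : Fin n × Fin n => p.1 < p.2 ∧ w p.2 < w p.1)).card

/-- The endpoint of the edge labeled `p = (i, j)` starting at `u`: right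
multiplication by the transposition `s_{ij}`. -/
def step (n : ℕ) (u : Equiv.Perm (Fin n)) (p : Fin n × Fin n) : Equiv.Perm (Fin n) :=
  u * Equiv.swap p.1 p.2

/-- `u → u·s_{ij}` is an edge of the quantum Bruhat graph `Γ_n`:
either `ℓ(u s_{ij}) = ℓ(u) + 1`, or `ℓ(u s_{ij}) = ℓ(u) + 1 - 2(j - i)`. -/
def isQBEdge (n : ℕ) (u : Equiv.Perm (Fin n)) (p : Fin n × Fin n) : Prop :=
  p.1 < p.2 ∧
    (len n (step n u p) = len n u + 1 ∨
     len n (step n u p) + 2 * ((p.2 : ℕ) - (p.1 : ℕ)) = len n u + 1)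

/-- The weight in `ℤ^{n-1}` of the edge labeled `p = (i,j)` starting at `u`:
`0` for a Bruhat cover, and `e_i + e_{i+1} + ⋯ + e_{j-1}` for a quantum edge.
(Here coordinates of `Fin (n-1)` are `0`-based: index `k` is the paper's `q_{k+1}`.) -/
def edgeWeight (n : ℕ) (u : Equiv.Perm (Fin n)) (p : Fin n × Fin n) : Fin (n - 1) → ℤ :=
  if len n (step n u p) = len n u + 1 then 0
  else fun k => if (p.1 : ℕ) ≤ (k : ℕ) ∧ (k : ℕ) < (p.2 : ℕ) then 1 else 0

/-- `isPath n u L v` : the list of labels `L` encodes a directed path from `u` to `v`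
in the quantum Bruhat graph `Γ_n`. -/
def isPath (n : ℕ) : Equiv.Perm (Fin n) → List (Fin n × Fin n) → Equiv.Perm (Fin n) → Prop
  | u, [], v => u = v
  | u, p :: ps, v => isQBEdge n u p ∧ isPath n (step n u p) ps v

/-- The weight of a directed path: the sum in `ℤ^{n-1}` of the weights of its edges. -/
def pathWeight (n : ℕ) : Equiv.Perm (Fin n) → List (Fin n × Fin n) → (Fin (n - 1) → ℤ)
  | _, [] => 0
  | u, p :: ps => edgeWeight n u p + pathWeight n (step n u p) ps

/-- Every edge of the path is length-increasing (a Bruhat cover). -/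
def allUp (n : ℕ) : Equiv.Perm (Fin n) → List (Fin n × Fin n) → Prop
  | _, [] => True
  | u, p :: ps => len n (step n u p) = len n u + 1 ∧ allUp n (step n u p) ps

/-- A path with labels `(a_1,b_1), …, (a_i,b_i)` is `y_k^i`-admissible if
`a_1 ≤ ⋯ ≤ a_i ≤ k < b_1, …, b_i` and the `b_t` are pairwise distinct.
(`k : Fin (n-1)` is `0`-based: it stands for the paper's `k+1`.) -/
def yAdm (n : ℕ) (k : Fin (n - 1)) (L : List (Fin n × Fin n)) : Prop :=
  List.Chain' (· ≤ ·) (L.map Prod.fst) ∧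
  (∀ p ∈ L, (p.1 : ℕ) ≤ (k : ℕ) ∧ (k : ℕ) < (p.2 : ℕ)) ∧
  (L.map Prod.snd).Nodup

/-- A path is `y^β`-admissible if it is a concatenation `P_1 ∘ ⋯ ∘ P_{n-1}` where
`P_k` is `y_k^{β_k}`-admissible. -/
def yBetaAdm (n : ℕ) (β : Fin (n - 1) → ℕ) (L : List (Fin n × Fin n)) : Prop :=
  ∃ Ls : Fin (n - 1) → List (Fin n × Fin n),
    L = (List.ofFn Ls).flatten ∧
    ∀ k : Fin (n - 1), (Ls k).length = β k ∧ yAdm n k (Ls k)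

/-- A path with labels `(a_1,b_1), …, (a_l,b_l)` is admissible if there are
`k_1 ≤ ⋯ ≤ k_l` with `a_t ≤ k_t < b_t` and the pairs `(k_t, b_t)` pairwise distinct. -/
def Adm (n : ℕ) (L : List (Fin n × Fin n)) : Prop :=
  ∃ ks : List ℕ, ks.length = L.length ∧ List.Chain' (· ≤ ·) ks ∧
    (∀ pr ∈ ks.zip L, (pr.2.1 : ℕ) ≤ pr.1 ∧ pr.1 < (pr.2.2 : ℕ)) ∧
    (ks.zip (L.map Prod.snd)).Nodup

/-- The longest permutation `w_o : i ↦ n + 1 - i` (0-based: `i ↦ n - 1 - i`). -/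
def wo (n : ℕ) : Equiv.Perm (Fin n) :=
  Function.Involutive.toPerm Fin.rev (fun i => Fin.rev_rev i)


/-- A double sum over a finite type, split along whether the indices lie in `{a, b}`. -/
lemma sum_sum_eq_sum_compl_pair {ι : Type*} [Fintype ι] [DecidableEq ι] {a b : ι} (hab : a ≠ b)
    (f : ι → ι → ℤ) (hf : ∀ x y, x ≠ a → x ≠ b → y ≠ a → y ≠ b → f x y = 0) :
    ∑ x, ∑ y, f x y = f a a + f a b + f b a + f b b +
      ∑ c ∈ ({a, b} : Finset ι)ᶜ, (f c a + f a c + f c b + f b c) := by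
  have split (g : ι → ℤ) : ∑ x, g x = g a + g b + ∑ c ∈ ({a, b} : Finset ι)ᶜ, g c := by
    rw [← Finset.sum_add_sum_compl {a, b} g, Finset.sum_pair hab]
  have hrow : ∑ x ∈ ({a, b} : Finset ι)ᶜ, ∑ y, f x y =
      ∑ x ∈ ({a, b} : Finset ι)ᶜ, (f x a + f x b) := by
    refine Finset.sum_congr rfl fun x hx => ?_
    simp only [Finset.mem_compl, Finset.mem_insert, Finset.mem_singleton, not_or] at hx
    rw [split, Finset.sum_eq_zero, add_zero]
    intro y hy
    simp only [Finset.mem_compl, Finset.mem_insert, Finset.mem_singleton, not_or] at hy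
    exact hf x y hx.1 hx.2 hy.1 hy.2
  rw [split, hrow, split (f a), split (f b)]
  simp only [Finset.sum_add_distrib]
  ring

lemma len_eq_sum (n : ℕ) (w : Equiv.Perm (Fin n)) :
    (len n w : ℤ) = ∑ x, ∑ y, if x < y ∧ w y < w x then 1 else 0 := by
  rw [len, Finset.card_filter, ← Finset.univ_product_univ, Finset.sum_product]
  push_cast
  rfl

/-- Multiplying by a transposition that creates an inversion at `a < b` increases the length by
one plus twice the number of positions between `a` and `b` whose value is intermediate. -/
lemma len_mul_swap {n : ℕ} (u : Equiv.Perm (Fin n)) {a b : Fin n} (hab : a < b)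
    (hu : u a < u b) :
    len n (u * Equiv.swap a b) = len n u + 1 +
      2 * (Finset.univ.filter fun c => (a < c ∧ c < b) ∧ u a < u c ∧ u c < u b).card := by
  set s := Equiv.swap a b with hs
  have hsa : s a = b := Equiv.swap_apply_left a b
  have hsb : s b = a := Equiv.swap_apply_right a b
  have hsc (c) (h1 : c ≠ a) (h2 : c ≠ b) : s c = c := Equiv.swap_apply_of_ne_of_ne h1 h2
  have hv : (len n (u * s) : ℤ) = ∑ x, ∑ y, if s x < s y ∧ u y < u x then 1 else 0 := by
    rw [len_eq_sum, ← Equiv.sum_comp s]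
    refine Finset.sum_congr rfl fun x _ => ?_
    rw [← Equiv.sum_comp s]
    refine Finset.sum_congr rfl fun y _ => ?_
    simp [hs]
  have hdiff : (len n (u * s) : ℤ) - len n u = 1 +
      2 * (Finset.univ.filter fun c => (a < c ∧ c < b) ∧ u a < u c ∧ u c < u b).card := by
    rw [hv, len_eq_sum]
    simp only [← Finset.sum_sub_distrib]
    rw [sum_sum_eq_sum_compl_pair hab.ne]
    · have hT : (Finset.univ.filter fun c => (a < c ∧ c < b) ∧ u a < u c ∧ u c < u b) =
          ({a, b} : Finset (Fin n))ᶜ.filter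
            fun c => (a < c ∧ c < b) ∧ u a < u c ∧ u c < u b := by
        ext c
        simp only [Finset.mem_filter, Finset.mem_univ, true_and, Finset.mem_compl,
          Finset.mem_insert, Finset.mem_singleton]
        grind
      rw [hT, Finset.card_filter, hsa, hsb]
      push_cast
      rw [Finset.mul_sum]
      congr 1
      · simp [hab, hu, hab.not_gt, hu.not_gt]
      · refine Finset.sum_congr rfl fun c hc => ?_
        simp only [Finset.mem_compl, Finset.mem_insert, Finset.mem_singleton, not_or] at hc
        obtain ⟨hca, hcb⟩ := hc
        rw [hsc c hca hcb]
        have h1 : u c ≠ u a := u.injective.ne hca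
        have h2 : u c ≠ u b := u.injective.ne hcb
        rcases lt_or_gt_of_ne hca with h3 | h3 <;> rcases lt_or_gt_of_ne hcb with h4 | h4 <;>
        rcases lt_or_gt_of_ne h1 with h5 | h5 <;> rcases lt_or_gt_of_ne h2 with h6 | h6 <;>
        first
        | (exfalso; order)
        | simp [h3, h4, h5, h6, h3.not_gt, h4.not_gt, h5.not_gt, h6.not_gt]
    · intro x y h1 h2 h3 h4
      rw [hsc x h1 h2, hsc y h3 h4, sub_self]
  omega

/-- Along a length-increasing edge into `v` labeled `p`, the values of `v` at the two swapped
positions form an inversion, and no position in between has an intermediate value. -/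
lemma isQBEdge.inversion_of_up {n : ℕ} {u v : Equiv.Perm (Fin n)} {p : Fin n × Fin n}
    (hv : step n u p = v) (hp : p.1 < p.2) (hlen : len n v = len n u + 1) :
    v p.2 < v p.1 ∧ ∀ c, p.1 < c → c < p.2 → v c < v p.2 ∨ v p.1 < v c := by
  obtain ⟨a, b⟩ := p
  simp only [step] at hv hp ⊢
  have hva : v a = u b := by simp [← hv]
  have hvb : v b = u a := by simp [← hv]
  have huv : v * Equiv.swap a b = u := by simp [← hv, mul_assoc]
  rcases lt_or_gt_of_ne (u.injective.ne hp.ne) with h | h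
  · have key := len_mul_swap u hp h
    rw [hv] at key
    have hzero := Finset.card_eq_zero.mp (by omega : (Finset.univ.filter
      fun c => (a < c ∧ c < b) ∧ u a < u c ∧ u c < u b).card = 0)
    refine ⟨by rw [hva, hvb]; exact h, fun c hac hcb => ?_⟩
    have hvc : v c = u c := by
      simp [← hv, Equiv.swap_apply_of_ne_of_ne hac.ne' hcb.ne]
    have hc := Finset.filter_eq_empty_iff.mp hzero (Finset.mem_univ c)
    have h1 : u c ≠ u a := u.injective.ne hac.ne'
    have h2 : u c ≠ u b := u.injective.ne hcb.ne
    rw [hva, hvb, hvc]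
    by_contra! hcon
    exact hc ⟨⟨hac, hcb⟩, lt_of_le_of_ne hcon.1 h1.symm, lt_of_le_of_ne hcon.2 h2⟩
  · have key := len_mul_swap v hp (by rw [hva, hvb]; exact h)
    rw [huv] at key
    omega

/-- Along a quantum edge into `v` labeled `p`, the values of `v` at all positions between the two
swapped ones are intermediate. -/
lemma isQBEdge.between_of_quantum {n : ℕ} {u v : Equiv.Perm (Fin n)} {p : Fin n × Fin n}
    (hv : step n u p = v) (hp : p.1 < p.2)
    (hlen : len n v + 2 * ((p.2 : ℕ) - (p.1 : ℕ)) = len n u + 1) :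
    v p.1 < v p.2 ∧ ∀ c, p.1 < c → c < p.2 → v p.1 < v c ∧ v c < v p.2 := by
  obtain ⟨a, b⟩ := p
  simp only [step] at hv hp hlen ⊢
  have hva : v a = u b := by simp [← hv]
  have hvb : v b = u a := by simp [← hv]
  have huv : v * Equiv.swap a b = u := by simp [← hv, mul_assoc]
  have hp' : (a : ℕ) < b := hp
  rcases lt_or_gt_of_ne (v.injective.ne hp.ne) with h | h
  · refine ⟨h, ?_⟩
    have key := len_mul_swap v hp h
    rw [huv] at key
    have hsub : (Finset.univ.filter fun c => (a < c ∧ c < b) ∧ v a < v c ∧ v c < v b) ⊆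
        Finset.Ioo a b := fun c hc => by
      simp only [Finset.mem_filter] at hc
      exact Finset.mem_Ioo.mpr hc.2.1
    have heq := Finset.eq_of_subset_of_card_le hsub (by rw [Fin.card_Ioo]; omega)
    intro c hac hcb
    have hc := Finset.mem_Ioo.mpr ⟨hac, hcb⟩
    rw [← heq] at hc
    exact (Finset.mem_filter.mp hc).2.2
  · have key := len_mul_swap u hp (by rw [← hva, ← hvb]; exact h)
    rw [hv] at key
    omega

lemma isPath_append {n : ℕ} {L M : List (Fin n × Fin n)} {u v : Equiv.Perm (Fin n)} :
    isPath n u (L ++ M) v ↔ ∃ w, isPath n u L w ∧ isPath n w M v := by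
  induction L generalizing u with
  | nil => simp [isPath]
  | cons p L ih => simp [isPath, ih, and_assoc]

lemma allUp_append {n : ℕ} {L M : List (Fin n × Fin n)} {u w : Equiv.Perm (Fin n)}
    (hL : isPath n u L w) : allUp n u (L ++ M) ↔ allUp n u L ∧ allUp n w M := by
  induction L generalizing u with
  | nil => cases hL; simp [allUp]
  | cons p L ih => simp [allUp, ih hL.2, and_assoc]

lemma pathWeight_eq_zero_of_allUp {n : ℕ} {L : List (Fin n × Fin n)} {u : Equiv.Perm (Fin n)}
    (h : allUp n u L) : pathWeight n u L = 0 := by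
  induction L generalizing u with
  | nil => rfl
  | cons p L ih => simp [pathWeight, edgeWeight, h.1, ih h.2]

/-- `w` agrees with the longest permutation on the first `k` positions. -/
def AgreesWithWo {n : ℕ} (k : ℕ) (w : Equiv.Perm (Fin n)) : Prop :=
  ∀ i : Fin n, (i : ℕ) < k → w i = i.rev

lemma AgreesWithWo.apply_lt {n k : ℕ} {w : Equiv.Perm (Fin n)} (hw : AgreesWithWo k w)
    {i j : Fin n} (hi : (i : ℕ) < k) (hij : i < j) : w j < w i := by
  rw [hw i hi]
  by_contra! h
  have hle : (w j).rev ≤ i := by rwa [← Fin.rev_le_rev, Fin.rev_rev]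
  have hrev : w (w j).rev = w j := by rw [hw _ (lt_of_le_of_lt hle hi), Fin.rev_rev]
  exact absurd (w.injective hrev ▸ hle) hij.not_ge

/-- Every position `b > k` outside `B` whose value exceeds the one at `k` is preceded, after `k`,
by a still larger value. -/
def NoRecordOutside {n : ℕ} (k : Fin n) (B : List (Fin n)) (w : Equiv.Perm (Fin n)) : Prop :=
  ∀ b, k < b → b ∉ B → w k < w b → ∃ c, k < c ∧ c < b ∧ w b < w c

/-- One edge of a `y_k`-admissible path: backwards from a vertex satisfying the invariants, only
length-increasing edges that move the position `k` are possible. -/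
lemma isQBEdge.up_of_invariants {n : ℕ} {k : Fin n} {B : List (Fin n)}
    {u : Equiv.Perm (Fin n)} {p : Fin n × Fin n} (he : isQBEdge n u p)
    (hpk : p.1 ≤ k) (hkp : k < p.2) (hB : p.2 ∉ B)
    (hagree : AgreesWithWo k (step n u p)) (hrec : NoRecordOutside k B (step n u p)) :
    len n (step n u p) = len n u + 1 ∧ AgreesWithWo k u ∧ NoRecordOutside k (p.2 :: B) u := by
  obtain ⟨hp, hup | hq⟩ := he
  · refine ⟨hup, ?_⟩
    obtain ⟨hinv, hbetw⟩ := isQBEdge.inversion_of_up rfl hp hup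
    have hpk' : p.1 = k := by
      by_contra hne
      have hlt : p.1 < k := lt_of_le_of_ne hpk hne
      rcases hbetw k hlt hkp with h | h
      · obtain ⟨c, hkc, hcb, hc⟩ := hrec p.2 hkp hB h
        rcases hbetw c (hlt.trans hkc) hcb with h' | h'
        · exact absurd h' hc.not_gt
        · exact absurd h' (hagree.apply_lt hlt (hlt.trans hkc)).not_gt
      · exact absurd h (hagree.apply_lt hlt hlt).not_gt
    obtain ⟨a, b⟩ := p
    subst hpk'
    simp only at *
    set v := step n u (a, b) with hv
    have hua : u a = v b := by simp [hv, step]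
    have hub : u b = v a := by simp [hv, step]
    have huc (c) (h1 : c ≠ a) (h2 : c ≠ b) : u c = v c := by
      simp [hv, step, Equiv.swap_apply_of_ne_of_ne h1 h2]
    constructor
    · intro i hi
      have hia : i < a := hi
      rw [huc i hia.ne (hia.trans hp).ne, hagree i hi]
    · intro d had hd hlt
      simp only [List.mem_cons, not_or] at hd
      rw [hua, huc d had.ne' hd.1] at hlt
      rw [huc d had.ne' hd.1]
      rcases lt_or_gt_of_ne (v.injective.ne had.ne) with h | h
      · obtain ⟨c, hac, hcd, hc⟩ := hrec d had hd.2 h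
        refine ⟨c, hac, hcd, ?_⟩
        rwa [huc c hac.ne']
        rintro rfl
        exact absurd hc hlt.not_gt
      · rcases lt_or_gt_of_ne hd.1 with hdb | hdb
        · rcases hbetw d had hdb with h' | h'
          · exact absurd h' hlt.not_gt
          · exact absurd h' h.not_gt
        · exact ⟨b, hp, hdb, by rwa [hub]⟩
  · exfalso
    obtain ⟨hlt, hbetw⟩ := isQBEdge.between_of_quantum rfl hp hq
    rcases hpk.lt_or_eq with h | h
    · exact absurd hlt (hagree.apply_lt h hp).not_gt
    · rw [h] at hlt hbetw
      obtain ⟨c, hkc, hcb, hc⟩ := hrec p.2 hkp hB hlt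
      exact absurd hc (hbetw c hkc hcb).2.not_gt

/-- A `y_k`-admissible path ending at a permutation that agrees with `w_o` up to position `k`
is length-increasing, and starts at one that agrees with `w_o` before position `k`. -/
lemma allUp_of_agreesWithWo {n : ℕ} {k : Fin n} {L : List (Fin n × Fin n)}
    {u w : Equiv.Perm (Fin n)} (hpath : isPath n u L w)
    (hL : ∀ p ∈ L, p.1 ≤ k ∧ k < p.2) (hnodup : (L.map Prod.snd).Nodup)
    (hw : AgreesWithWo (k + 1) w) :
    allUp n u L ∧ AgreesWithWo k u ∧ NoRecordOutside k (L.map Prod.snd) u := by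
  induction L generalizing u with
  | nil =>
    cases hpath
    exact ⟨trivial, fun i hi => hw i (by omega),
      fun b hb _ h => absurd h (hw.apply_lt (Nat.lt_succ_self _) hb).not_gt⟩
  | cons p L ih =>
    rw [List.map_cons, List.nodup_cons] at hnodup
    obtain ⟨hup, hagree, hrec⟩ :=
      ih hpath.2 (fun q hq => hL q (List.mem_cons_of_mem p hq)) hnodup.2
    obtain ⟨hpk, hkp⟩ := hL p List.mem_cons_self
    obtain ⟨h1, h2, h3⟩ := hpath.1.up_of_invariants hpk hkp hnodup.1 hagree hrec
    exact ⟨⟨h1, hup⟩, h2, h3⟩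

/-- The last blocks of a `y^β`-admissible path to `w_o`, from the block with index `k` on, form a
length-increasing path starting at a permutation that agrees with `w_o` before position `k`. -/
lemma allUp_drop_flatten {n : ℕ} {Ls : Fin (n - 1) → List (Fin n × Fin n)}
    (hLs : ∀ k, yAdm n k (Ls k)) {k : ℕ} (hk : k ≤ n - 1) {u : Equiv.Perm (Fin n)}
    (hpath : isPath n u ((List.ofFn Ls).drop k).flatten (wo n)) :
    allUp n u ((List.ofFn Ls).drop k).flatten ∧ AgreesWithWo k u := by
  induction hk using Nat.decreasingInduction generalizing u with
  | self =>
    rw [List.drop_eq_nil_of_le (by simp)] at hpath ⊢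
    cases hpath
    exact ⟨trivial, fun i _ => rfl⟩
  | of_succ k hk ih =>
    rw [List.drop_eq_getElem_cons (by simpa using hk), List.flatten_cons, List.getElem_ofFn]
      at hpath ⊢
    obtain ⟨w, hu, hw⟩ := isPath_append.mp hpath
    obtain ⟨hup, hagree⟩ := ih hw
    obtain ⟨-, hbounds, hnodup⟩ := hLs ⟨k, hk⟩
    obtain ⟨hup', hagree', -⟩ := allUp_of_agreesWithWo (k := ⟨k, by omega⟩) hu
      (fun p hp => hbounds p hp) hnodup hagree
    exact ⟨(allUp_append hu).mpr ⟨hup', hup⟩, hagree'⟩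

/-- Every `y^β`-admissible directed path in `Γ_n` ending at the longest permutation
`w_o` has weight `0` in `ℤ^{n-1}`; equivalently, every edge of such a path is
length-increasing, so the path is a saturated chain in the Bruhat order. -/
theorem admissible_path_to_wo_weight_zero (n : ℕ) (hn : 2 ≤ n)
    (u : Equiv.Perm (Fin n)) (β : Fin (n - 1) → ℕ) (L : List (Fin n × Fin n))
    (hpath : isPath n u L (wo n)) (hadm : yBetaAdm n β L) :
    pathWeight n u L = 0 ∧ allUp n u L := by
  obtain ⟨Ls, rfl, hLs⟩ := hadm
  have h := (allUp_drop_flatten (fun k => (hLs k).2) (Nat.zero_le _) hpath).1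
  exact ⟨pathWeight_eq_zero_of_allUp h, h⟩
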